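/- Let (J,𝓑,η) be a (k,p)-loose Markov space and (W_n)_{n≥1} a sequence of 1-regular graphons on (J,𝓑,π) such that η is the (k,p)-limit of (W_n): s_k^{W_n} → s_k^η in L^p(π^k) and there is a constant C>0 with ‖s_k^{W_n}‖_{L^p(π^k)} ≤ C for all n, where s_k^W(y_1,…,y_k) := ∫_J ∏_{i=1}^k W(x,y_i) dπ(x). Let G=(U,W,E) be a bigraph with deg(u)≤p for all u∈U and deg(w)≤k for all w∈W. Then t(G,η) < ∞ and t(G,W_n) → t(G,η) as n→∞. -/

import Mathlib

open MeasureTheory ProbabilityTheory Finset Filter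
open scoped ENNReal

variable {J : Type*} [MeasurableSpace J]

/-- The joint law `σ_k` of `k` independent single steps of the kernel `P`, started from a
common `π`-random point; here the steps are indexed by an arbitrary finite type `ι`. -/
noncomputable def stepMeasureIdx (π : Measure J) (P : Kernel J J) (ι : Type*) [Fintype ι] :
    Measure (ι → J) :=
  π.bind fun x => Measure.pi fun _ : ι => P x

/-- The density `s_ι = dσ_ι/dπ^ι`. -/
noncomputable def stepDensityIdx (π : Measure J) (P : Kernel J J) (ι : Type*) [Fintype ι] :
    (ι → J) → ℝ≥0∞ :=
  (stepMeasureIdx π P ι).rnDeriv (Measure.pi fun _ : ι => π)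

/-- `k`-looseness: `σ_k ≪ π^k`. -/
def KLoose (π : Measure J) (P : Kernel J J) (k : ℕ) : Prop :=
  stepMeasureIdx π P (Fin k) ≪ Measure.pi fun _ : Fin k => π

/-- `(k,p)`-looseness: `k`-loose and `s_k ∈ L^p(π^k)`. -/
def KPLoose (π : Measure J) (P : Kernel J J) (k p : ℕ) : Prop :=
  KLoose π P k ∧
    ∫⁻ x, stepDensityIdx π P (Fin k) x ^ p ∂(Measure.pi fun _ : Fin k => π) < ⊤

section Bigraph

variable {U W' : Type*} [Fintype U] [Fintype W'] [DecidableEq U] [DecidableEq W']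

/-- Neighbourhood in `U` of a right vertex `w` of a bigraph with edge set `E ⊆ U × W`. -/
def nbrW (E : Finset (U × W')) (w : W') : Finset U :=
  Finset.univ.filter fun u => (u, w) ∈ E

/-- Neighbourhood in `W` of a left vertex `u` of a bigraph with edge set `E ⊆ U × W`. -/
def nbrU (E : Finset (U × W')) (u : U) : Finset W' :=
  Finset.univ.filter fun w => (u, w) ∈ E

/-- `ψ` is a *star disintegration family* for `(π, P)` over the finite index type `ι`:
a measurable family `(ψ_x : x ∈ J^ι)` of finite measures on `J` with
`∫_A ψ_x(B) dπ^ι(x) = ∫_B P_y^{⊗ι}(A) dπ(y)` for all measurable `A ⊆ J^ι`, `B ⊆ J`.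
Informally, `ψ_x` is the measure on common neighbours of the points `x i`. -/
def IsStarDisint (π : Measure J) (P : Kernel J J) {ι : Type*} [Fintype ι]
    (ψ : Kernel (ι → J) J) : Prop :=
  (∀ x, IsFiniteMeasure (ψ x)) ∧
  ∀ (A : Set (ι → J)) (B : Set J), MeasurableSet A → MeasurableSet B →
    ∫⁻ x in A, ψ x B ∂(Measure.pi fun _ : ι => π)
      = ∫⁻ y in B, (Measure.pi fun _ : ι => P y) A ∂π

/-- The homomorphism measure `η^G` on `J^U × J^W` of a bigraph `G = (U, W, E)`, built from a
star disintegration family `ψ`: the points of `U` are i.i.d. `π`-points `x`, and the points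
`w ∈ W` are then independent with "distributions" `ψ_w (x|_{N(w)})`.  On boxes,
`η^G(∏ A_u × ∏ B_w) = ∫_{∏ A_u} ∏_w ψ_{x|N(w)}(B_w) dπ^U(x)`. -/
noncomputable def homMeasure (π : Measure J) (E : Finset (U × W'))
    (ψ : ∀ w : W', Kernel (↥(nbrW E w) → J) J) : Measure ((U → J) × (W' → J)) :=
  (Measure.pi fun _ : U => π).bind fun x =>
    (Measure.dirac x).prod (Measure.pi fun w : W' => ψ w fun u => x u.1)

/-- The `1`-regular step graphon of the Markov space `η` associated with the finite partition
encoded by the classifying map `c : J → Fin mm`: its value at `(a, b)` is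
`η(P(a) × P(b)) / (π(P(a)) π(P(b)))` where `P(z)` is the partition class of `z`. -/
noncomputable def stepW (η : Measure (J × J)) {mm : ℕ} (c : J → Fin mm) (a b : J) : ℝ≥0∞ :=
  η ((c ⁻¹' {c a}) ×ˢ (c ⁻¹' {c b})) /
    ((η.map Prod.fst) (c ⁻¹' {c a}) * (η.map Prod.fst) (c ⁻¹' {c b}))

/-- The value of the homomorphism measure `η_𝒫^G = (W_𝒫)^G ⬝ π^V` of the bigraph
`G = (U, W, E)` in the step graphon of the partition `c`, on the box `∏ A_u × ∏ B_w`. -/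
noncomputable def stepBoxVal (η : Measure (J × J)) {mm : ℕ} (c : J → Fin mm)
    (E : Finset (U × W')) (A : U → Set J) (B : W' → Set J) : ℝ≥0∞ :=
  ∫⁻ x : U → J in Set.univ.pi A,
    ∫⁻ y : W' → J in Set.univ.pi B,
      ∏ e ∈ E, stepW η c (x e.1) (y e.2)
    ∂(Measure.pi fun _ : W' => η.map Prod.fst) ∂(Measure.pi fun _ : U => η.map Prod.fst)

end Bigraph

/-- The star density of a graphon `W` over a finite index type `ι`:
`s_ι^W(y) = ∫ ∏_{i} W(x, y_i) dπ(x)`. -/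
noncomputable def sGraphon (π : Measure J) (W : J → J → ℝ≥0∞) (ι : Type*) [Fintype ι] :
    (ι → J) → ℝ≥0∞ :=
  fun y => ∫⁻ x, ∏ i : ι, W x (y i) ∂π

/-- The homomorphism density `t(G, W)` of the bigraph `G = (U, W', E)` in a graphon `W`. -/
noncomputable def tGraphon {U W' : Type*} [Fintype U] [Fintype W']
    (π : Measure J) (W : J → J → ℝ≥0∞) (E : Finset (U × W')) : ℝ≥0∞ :=
  ∫⁻ x : U → J, ∫⁻ y : W' → J, ∏ e ∈ E, W (x e.1) (y e.2)
    ∂(Measure.pi fun _ : W' => π) ∂(Measure.pi fun _ : U => π)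

/-- The homomorphism density `t(G, η)` of the bigraph `G = (U, W', E)` in the Markov space
with stationary distribution `π` and kernel `P`:
`t(G,η) = ∫_{J^U} ∏_{w ∈ W'} s_{deg w}(x|_{N(w)}) dπ^U(x)`. -/
noncomputable def tEta {U W' : Type*} [Fintype U] [Fintype W'] [DecidableEq U] [DecidableEq W']
    (π : Measure J) (P : Kernel J J) (E : Finset (U × W')) : ℝ≥0∞ :=
  ∫⁻ x : U → J, ∏ w : W', stepDensityIdx π P (↥(nbrW E w)) (fun u => x u.1)
    ∂(Measure.pi fun _ : U => π)

/-- Hölder's inequality on a probability space for at most `p` functions in `L^p`. -/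
theorem lintegral_prod_rpow_inv_le {α ι : Type*} [MeasurableSpace α] (ν : Measure α)
    [IsProbabilityMeasure ν] (s : Finset ι) {f : ι → α → ℝ≥0∞}
    (hf : ∀ i ∈ s, AEMeasurable (f i) ν) {p : ℕ} (hp : 0 < p) (hs : #s ≤ p) :
    ∫⁻ a, ∏ i ∈ s, f i a ^ (p : ℝ)⁻¹ ∂ν ≤ ∏ i ∈ s, (∫⁻ a, f i a ∂ν) ^ (p : ℝ)⁻¹ := by
  have hp' : (0 : ℝ) < p := by exact_mod_cast hp
  have hs' : (#s : ℝ) * (p : ℝ)⁻¹ ≤ 1 := by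
    rw [← div_eq_mul_inv, div_le_one hp']
    exact_mod_cast hs
  have h := ENNReal.lintegral_mul_prod_norm_pow_le (μ := ν) s (g := fun _ => 1) (f := f)
    aemeasurable_const hf (1 - #s * (p : ℝ)⁻¹) (p := fun _ => (p : ℝ)⁻¹) (by simp)
    (by linarith) (fun _ _ => by positivity)
  simpa using h

/-- Pointwise, marginalised form of Finner's generalisation of Hölder's inequality. -/
theorem lmarginal_prod_rpow_inv_le {U ι X : Type*} [DecidableEq U] [MeasurableSpace X]
    (μ : Measure X) [IsProbabilityMeasure μ] (s : Finset ι) (A : ι → Finset U)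
    {f : ι → (U → X) → ℝ≥0∞} (hf : ∀ i, Measurable (f i))
    (hA : ∀ i, ∀ u ∉ A i, ∀ x a, f i (Function.update x u a) = f i x) {p : ℕ} (hp : 0 < p)
    (hdeg : ∀ u, #{i ∈ s | u ∈ A i} ≤ p) (T : Finset U) (x : U → X) :
    (∫⋯∫⁻_T, (fun x => ∏ i ∈ s, f i x ^ (p : ℝ)⁻¹) ∂fun _ => μ) x
      ≤ ∏ i ∈ s, ((∫⋯∫⁻_T, f i ∂fun _ => μ) x) ^ (p : ℝ)⁻¹ := by
  have hmeas : Measurable fun x => ∏ i ∈ s, f i x ^ (p : ℝ)⁻¹ :=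
    Finset.measurable_prod _ fun i _ => (hf i).pow_const _
  induction T using Finset.induction_on generalizing x with
  | empty => simp
  | insert u T hu ih =>
    rw [lmarginal_insert _ hmeas hu]
    simp_rw [lmarginal_insert _ (hf _) hu]
    refine (lintegral_mono fun a => ih _).trans ?_
    have hconst : ∀ i, u ∉ A i → ∀ a,
        (∫⋯∫⁻_T, f i ∂fun _ => μ) (Function.update x u a) = (∫⋯∫⁻_T, f i ∂fun _ => μ) x := by
      intro i hi a
      rw [lmarginal_update_of_notMem (hf i) hu]
      congr 1
      ext y
      exact hA i u hi y a
    have hg : ∀ i, Measurable fun a => (∫⋯∫⁻_T, f i ∂fun _ => μ) (Function.update x u a) :=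
      fun i => ((hf i).lmarginal _).comp (measurable_update x)
    rw [← Finset.prod_filter_mul_prod_filter_not s (fun i => u ∈ A i)]
    have hsplit : ∀ a, ∏ i ∈ s, ((∫⋯∫⁻_T, f i ∂fun _ => μ) (Function.update x u a)) ^ (p : ℝ)⁻¹
        = (∏ i ∈ s with u ∈ A i,
            ((∫⋯∫⁻_T, f i ∂fun _ => μ) (Function.update x u a)) ^ (p : ℝ)⁻¹)
          * ∏ i ∈ s with u ∉ A i, ((∫⋯∫⁻_T, f i ∂fun _ => μ) x) ^ (p : ℝ)⁻¹ := by
      intro a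
      rw [← Finset.prod_filter_mul_prod_filter_not s (fun i => u ∈ A i)]
      congr 1
      refine Finset.prod_congr rfl fun i hi => ?_
      rw [hconst i (Finset.mem_filter.1 hi).2]
    simp_rw [hsplit]
    rw [lintegral_mul_const _ (Finset.measurable_prod _ fun i _ => (hg i).pow_const _)]
    refine mul_le_mul' (lintegral_prod_rpow_inv_le μ _ (fun i _ => (hg i).aemeasurable) hp
      (hdeg u)) (le_of_eq ?_)
    refine Finset.prod_congr rfl fun i hi => ?_
    simp_rw [hconst i (Finset.mem_filter.1 hi).2]
    simp

/-- **Finner's inequality** on a finite power of a probability space: if every coordinate is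
relevant for at most `p` of the functions, the integral of their product is at most the product
of their `L^p` norms. -/
theorem lintegral_prod_le_prod_lintegral_rpow {U ι X : Type*} [Fintype U] [DecidableEq U]
    [MeasurableSpace X] (μ : Measure X) [IsProbabilityMeasure μ] (s : Finset ι)
    (A : ι → Finset U) {f : ι → (U → X) → ℝ≥0∞} (hf : ∀ i, Measurable (f i))
    (hA : ∀ i, ∀ u ∉ A i, ∀ x a, f i (Function.update x u a) = f i x) {p : ℕ} (hp : 0 < p)
    (hdeg : ∀ u, #{i ∈ s | u ∈ A i} ≤ p) :
    ∫⁻ x, ∏ i ∈ s, f i x ∂(Measure.pi fun _ : U => μ)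
      ≤ ∏ i ∈ s, (∫⁻ x, f i x ^ (p : ℝ) ∂(Measure.pi fun _ : U => μ)) ^ (p : ℝ)⁻¹ := by
  have : Nonempty X := nonempty_of_isProbabilityMeasure μ
  have h := lmarginal_prod_rpow_inv_le μ s A (f := fun i x => f i x ^ (p : ℝ))
    (fun i => (hf i).pow_const _) (fun i u hu x a => by rw [hA i u hu]) hp hdeg Finset.univ
    (fun _ => Classical.arbitrary X)
  simp only [lmarginal_univ] at h
  refine le_trans (le_of_eq ?_) h
  refine lintegral_congr fun x => Finset.prod_congr rfl fun i _ => ?_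
  rw [← ENNReal.rpow_mul, mul_inv_cancel₀ (by exact_mod_cast hp.ne'), ENNReal.rpow_one]

/-- Expanding a product of sums and applying Finner's inequality to each term: the error made
by replacing `g + d` by `g` in the product is controlled by the `L^p` norms. -/
theorem lintegral_prod_le_add_sum {U ι X : Type*} [Fintype U] [DecidableEq U] [Fintype ι]
    [DecidableEq ι] [MeasurableSpace X] (μ : Measure X) [IsProbabilityMeasure μ]
    (A : ι → Finset U) {f g d : ι → (U → X) → ℝ≥0∞} (hg : ∀ i, Measurable (g i))
    (hd : ∀ i, Measurable (d i)) (hfgd : ∀ i x, f i x ≤ g i x + d i x)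
    (hgA : ∀ i, ∀ u ∉ A i, ∀ x a, g i (Function.update x u a) = g i x)
    (hdA : ∀ i, ∀ u ∉ A i, ∀ x a, d i (Function.update x u a) = d i x) {p : ℕ} (hp : 0 < p)
    (hdeg : ∀ u, #{i | u ∈ A i} ≤ p) :
    ∫⁻ x, ∏ i, f i x ∂(Measure.pi fun _ : U => μ)
      ≤ ∫⁻ x, ∏ i, g i x ∂(Measure.pi fun _ : U => μ)
        + ∑ t ∈ (Finset.univ : Finset (Finset ι)).erase Finset.univ,
          (∏ i ∈ t, (∫⁻ x, g i x ^ (p : ℝ) ∂(Measure.pi fun _ : U => μ)) ^ (p : ℝ)⁻¹)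
            * ∏ i ∈ tᶜ, (∫⁻ x, d i x ^ (p : ℝ) ∂(Measure.pi fun _ : U => μ)) ^ (p : ℝ)⁻¹ := by
  have hterm : ∀ t : Finset ι, Measurable fun x => (∏ i ∈ t, g i x) * ∏ i ∈ tᶜ, d i x := fun t =>
    (Finset.measurable_prod _ fun i _ => hg i).mul (Finset.measurable_prod _ fun i _ => hd i)
  calc ∫⁻ x, ∏ i, f i x ∂(Measure.pi fun _ : U => μ)
      ≤ ∫⁻ x, ∑ t : Finset ι, (∏ i ∈ t, g i x) * ∏ i ∈ tᶜ, d i x ∂(Measure.pi fun _ => μ) := by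
        refine lintegral_mono fun x => ?_
        rw [← Fintype.prod_add]
        exact Finset.prod_le_prod' fun i _ => hfgd i x
    _ = ∑ t : Finset ι, ∫⁻ x, (∏ i ∈ t, g i x) * ∏ i ∈ tᶜ, d i x ∂(Measure.pi fun _ => μ) :=
        lintegral_finsetSum _ fun t _ => hterm t
    _ ≤ _ := by
        rw [← Finset.add_sum_erase _ _ (Finset.mem_univ (Finset.univ : Finset ι))]
        refine add_le_add (le_of_eq (by simp)) (Finset.sum_le_sum fun t _ => ?_)
        have h := lintegral_prod_le_prod_lintegral_rpow μ Finset.univ A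
          (f := fun i => if i ∈ t then g i else d i)
          (fun i => by split_ifs <;> [exact hg i; exact hd i])
          (fun i u hu x a => by
            split_ifs <;> [exact hgA i u hu x a; exact hdA i u hu x a]) hp hdeg
        have hpiece : ∀ F G : ι → ℝ≥0∞,
            (∏ i ∈ t, F i) * ∏ i ∈ tᶜ, G i = ∏ i, if i ∈ t then F i else G i := by
          intro F G
          rw [← Finset.prod_mul_prod_compl t]
          congr 1 <;> refine Finset.prod_congr rfl fun i hi => ?_
          · rw [if_pos hi]
          · rw [if_neg (Finset.mem_compl.1 hi)]
        simp_rw [hpiece]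
        refine (le_of_eq ?_).trans (h.trans (le_of_eq ?_))
        · refine lintegral_congr fun x => Finset.prod_congr rfl fun i _ => ?_
          split_ifs <;> rfl
        · refine Finset.prod_congr rfl fun i _ => ?_
          split_ifs <;> rfl

/-- Convergence in `L^p` of the factors implies convergence of the integral of the product, when
every coordinate is relevant for at most `p` of the factors. -/
theorem tendsto_lintegral_prod {U ι X : Type*} [Fintype U] [DecidableEq U] [Fintype ι]
    [DecidableEq ι] [MeasurableSpace X] (μ : Measure X) [IsProbabilityMeasure μ]
    (A : ι → Finset U) {a : ℕ → ι → (U → X) → ℝ≥0∞} {b : ι → (U → X) → ℝ≥0∞}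
    (ha : ∀ n i, Measurable (a n i)) (hb : ∀ i, Measurable (b i))
    (haA : ∀ n i, ∀ u ∉ A i, ∀ x y, a n i (Function.update x u y) = a n i x)
    (hbA : ∀ i, ∀ u ∉ A i, ∀ x y, b i (Function.update x u y) = b i x) {p : ℕ} (hp : 0 < p)
    (hdeg : ∀ u, #{i | u ∈ A i} ≤ p)
    (hbp : ∀ i, ∫⁻ x, b i x ^ (p : ℝ) ∂(Measure.pi fun _ : U => μ) < ⊤)
    (hlim : ∀ i, Tendsto (fun n => ∫⁻ x, ((a n i x - b i x) + (b i x - a n i x)) ^ (p : ℝ)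
      ∂(Measure.pi fun _ : U => μ)) atTop (nhds 0)) :
    ∫⁻ x, ∏ i, b i x ∂(Measure.pi fun _ : U => μ) < ⊤ ∧
    Tendsto (fun n => ∫⁻ x, ∏ i, a n i x ∂(Measure.pi fun _ : U => μ)) atTop
      (nhds (∫⁻ x, ∏ i, b i x ∂(Measure.pi fun _ : U => μ))) := by
  set d : ℕ → ι → (U → X) → ℝ≥0∞ := fun n i x => (a n i x - b i x) + (b i x - a n i x) with hd_def
  have hd : ∀ n i, Measurable (d n i) := fun n i =>
    ((ha n i).sub (hb i)).add ((hb i).sub (ha n i))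
  have hdA : ∀ n i, ∀ u ∉ A i, ∀ x y, d n i (Function.update x u y) = d n i x := by
    intro n i u hu x y
    simp only [hd_def, haA n i u hu, hbA i u hu]
  have hab : ∀ n i x, a n i x ≤ b i x + d n i x := fun n i x =>
    le_add_tsub.trans (add_le_add le_rfl le_self_add)
  have hba : ∀ n i x, b i x ≤ a n i x + d n i x := fun n i x =>
    le_add_tsub.trans (add_le_add le_rfl le_add_self)
  have hp1 : (1 : ℝ) ≤ p := by exact_mod_cast hp
  have hpinv : (0 : ℝ) < (p : ℝ)⁻¹ := by positivity
  let N : ((U → X) → ℝ≥0∞) → ℝ≥0∞ := fun f =>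
    (∫⁻ x, f x ^ (p : ℝ) ∂(Measure.pi fun _ : U => μ)) ^ (p : ℝ)⁻¹
  have hNb : ∀ i, N (b i) ≠ ⊤ := fun i => ENNReal.rpow_ne_top_of_nonneg hpinv.le (hbp i).ne
  have hNd : ∀ i, Tendsto (fun n => N (d n i)) atTop (nhds 0) := by
    intro i
    have := (ENNReal.continuous_rpow_const (y := (p : ℝ)⁻¹)).tendsto 0 |>.comp (hlim i)
    rwa [ENNReal.zero_rpow_of_pos hpinv] at this
  have hNa : ∀ n i, N (a n i) ≤ N (b i) + N (d n i) := by
    intro n i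
    have h := ENNReal.lintegral_Lp_add_le (μ := Measure.pi fun _ : U => μ) (hb i).aemeasurable
      (hd n i).aemeasurable hp1
    rw [one_div] at h
    refine le_trans (ENNReal.rpow_le_rpow (lintegral_mono fun x => ?_) hpinv.le) h
    exact ENNReal.rpow_le_rpow (hab n i x) (by positivity)
  have hfin : ∫⁻ x, ∏ i, b i x ∂(Measure.pi fun _ : U => μ) < ⊤ :=
    (lintegral_prod_le_prod_lintegral_rpow μ Finset.univ A hb hbA hp hdeg).trans_lt
      (ENNReal.prod_lt_top fun i _ => (hNb i).lt_top)
  let ε : ℕ → ℝ≥0∞ := fun n => ∑ t ∈ (Finset.univ : Finset (Finset ι)).erase Finset.univ,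
    (∏ i ∈ t, (N (b i) + N (d n i))) * ∏ i ∈ tᶜ, N (d n i)
  have hε : Tendsto ε atTop (nhds 0) := by
    rw [← Finset.sum_const_zero (s := (Finset.univ : Finset (Finset ι)).erase Finset.univ)]
    refine tendsto_finsetSum _ fun t ht => ?_
    obtain ⟨j, hj⟩ : tᶜ.Nonempty := by
      rw [Finset.nonempty_iff_ne_empty, Ne, Finset.compl_eq_empty_iff]
      exact (Finset.mem_erase.1 ht).1
    have h1 : Tendsto (fun n => ∏ i ∈ t, (N (b i) + N (d n i))) atTop
        (nhds (∏ i ∈ t, (N (b i) + 0))) :=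
      ENNReal.tendsto_finsetProd_of_ne_top _ (fun i _ => tendsto_const_nhds.add (hNd i))
        (fun i _ => by simpa using hNb i)
    have h2 : Tendsto (fun n => ∏ i ∈ tᶜ, N (d n i)) atTop (nhds (∏ i ∈ tᶜ, 0)) :=
      ENNReal.tendsto_finsetProd_of_ne_top _ (fun i _ => hNd i) (fun i _ => by simp)
    rw [Finset.prod_eq_zero hj rfl] at h2
    have h3 := ENNReal.Tendsto.mul h1 (Or.inr (by simp)) h2 (Or.inr
      (ENNReal.prod_ne_top fun i _ => by simpa using hNb i))
    simpa using h3
  refine ⟨hfin, ?_⟩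
  have hupper : ∀ n, ∫⁻ x, ∏ i, a n i x ∂(Measure.pi fun _ : U => μ)
      ≤ ∫⁻ x, ∏ i, b i x ∂(Measure.pi fun _ : U => μ) + ε n := by
    intro n
    refine (lintegral_prod_le_add_sum μ A hb (hd n) (hab n) hbA (hdA n) hp hdeg).trans ?_
    refine add_le_add le_rfl (Finset.sum_le_sum fun t _ => mul_le_mul' ?_ le_rfl)
    exact Finset.prod_le_prod' fun i _ => le_self_add
  have hlower : ∀ n, ∫⁻ x, ∏ i, b i x ∂(Measure.pi fun _ : U => μ) - ε n
      ≤ ∫⁻ x, ∏ i, a n i x ∂(Measure.pi fun _ : U => μ) := by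
    intro n
    rw [tsub_le_iff_right]
    refine (lintegral_prod_le_add_sum μ A (ha n) (hd n) (hba n) (haA n) (hdA n) hp hdeg).trans ?_
    refine add_le_add le_rfl (Finset.sum_le_sum fun t _ => mul_le_mul' ?_ le_rfl)
    exact Finset.prod_le_prod' fun i _ => hNa n i
  refine tendsto_of_tendsto_of_tendsto_of_le_of_le ?_ ?_ hlower hupper
  · simpa using ENNReal.Tendsto.sub (tendsto_const_nhds (x := ∫⁻ x, ∏ i, b i x
      ∂(Measure.pi fun _ : U => μ))) hε (Or.inl hfin.ne)
  · simpa using tendsto_const_nhds.add hε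

/-- The integral of a product of functions of independent coordinates. -/
theorem lintegral_pi_prod_eq_prod {ι X : Type*} [Fintype ι] [MeasurableSpace X]
    (μ : Measure X) [IsProbabilityMeasure μ] {f : ι → X → ℝ≥0∞} (hf : ∀ i, Measurable (f i)) :
    ∫⁻ x : ι → X, ∏ i, f i (x i) ∂(Measure.pi fun _ => μ) = ∏ i, ∫⁻ y, f i y ∂μ := by
  have hind : iIndepFun (fun i (x : ι → X) => f i (x i)) (Measure.pi fun _ => μ) :=
    iIndepFun_pi (X := f) fun i => (hf i).aemeasurable
  rw [lintegral_prod_eq_prod_lintegral_of_indepFun Finset.univ _ hind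
    fun i => (hf i).comp (measurable_pi_apply i)]
  exact Finset.prod_congr rfl fun i _ =>
    (measurePreserving_eval (fun _ : ι => μ) i).lintegral_comp (hf i)

section Glue

variable {ι κ l X : Type*}

/-- Combine two tuples into one along a bijection of the index types. -/
def glue (e : ι ⊕ κ ≃ l) (q : (ι → X) × (κ → X)) : l → X := fun i => Sum.elim q.1 q.2 (e.symm i)

theorem glue_apply_inl (e : ι ⊕ κ ≃ l) (q : (ι → X) × (κ → X)) (i : ι) :
    glue e q (e (.inl i)) = q.1 i := by simp [glue]

theorem glue_apply_inr (e : ι ⊕ κ ≃ l) (q : (ι → X) × (κ → X)) (i : κ) :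
    glue e q (e (.inr i)) = q.2 i := by simp [glue]

variable [MeasurableSpace X]

theorem measurable_glue (e : ι ⊕ κ ≃ l) : Measurable (glue (X := X) e) := by
  refine measurable_pi_lambda _ fun i => ?_
  obtain ⟨j, rfl⟩ := e.surjective i
  cases j with
  | inl j =>
    simp only [glue_apply_inl]
    exact (measurable_pi_apply j).comp measurable_fst
  | inr j =>
    simp only [glue_apply_inr]
    exact (measurable_pi_apply j).comp measurable_snd

variable [Fintype ι] [Fintype κ] [Fintype l]

theorem measurePreserving_glue (e : ι ⊕ κ ≃ l) (μ : Measure X) [IsProbabilityMeasure μ] :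
    MeasurePreserving (glue e) ((Measure.pi fun _ : ι => μ).prod (Measure.pi fun _ : κ => μ))
      (Measure.pi fun _ : l => μ) := by
  refine ⟨measurable_glue e, (Measure.pi_eq fun s hs => ?_).symm⟩
  have hpre : glue e ⁻¹' Set.univ.pi s
      = (Set.univ.pi fun i => s (e (.inl i))) ×ˢ (Set.univ.pi fun i => s (e (.inr i))) := by
    ext q
    simp only [Set.mem_preimage, Set.mem_univ_pi, Set.mem_prod]
    rw [← e.forall_congr_right, Sum.forall]
    simp only [glue_apply_inl, glue_apply_inr]
  rw [Measure.map_apply (measurable_glue e) (MeasurableSet.univ_pi hs), hpre, Measure.prod_prod,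
    Measure.pi_pi, Measure.pi_pi, ← e.prod_comp, Fintype.prod_sum_type]

/-- The law of a subtuple of an i.i.d. tuple. -/
theorem measurePreserving_comp_inl (e : ι ⊕ κ ≃ l) (μ : Measure X) [IsProbabilityMeasure μ] :
    MeasurePreserving (fun (z : l → X) i => z (e (.inl i))) (Measure.pi fun _ : l => μ)
      (Measure.pi fun _ : ι => μ) := by
  have hr : Measurable fun (z : l → X) (i : ι) => z (e (.inl i)) :=
    measurable_pi_lambda _ fun i => measurable_pi_apply _
  refine ⟨hr, ?_⟩
  rw [← (measurePreserving_glue e μ).map_eq, Measure.map_map hr (measurable_glue e)]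
  have : (fun (z : l → X) (i : ι) => z (e (.inl i))) ∘ glue e = Prod.fst := by
    ext q i
    exact glue_apply_inl e q i
  rw [this, Measure.map_fst_prod]
  simp

theorem measurePreserving_restrict_finset (s : Finset l) [DecidableEq l] (μ : Measure X)
    [IsProbabilityMeasure μ] :
    MeasurePreserving (fun (z : l → X) (i : s) => z i) (Measure.pi fun _ : l => μ)
      (Measure.pi fun _ : s => μ) :=
  measurePreserving_comp_inl (Equiv.sumCompl (· ∈ s)) μ

end Glue

theorem measurable_pi_const {α X ι : Type*} [Fintype ι] [MeasurableSpace α] [MeasurableSpace X]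
    (P : Kernel α X) [IsMarkovKernel P] : Measurable fun x => Measure.pi fun _ : ι => P x := by
  refine Measurable.measure_of_isPiSystem_of_isProbabilityMeasure generateFrom_pi.symm
    isPiSystem_pi ?_
  rintro _ ⟨s, hs, rfl⟩
  simp_rw [Measure.pi_pi]
  exact Finset.measurable_prod _ fun i _ => P.measurable_coe (hs i (Set.mem_univ i))

section Star

variable {ι κ l : Type*} [Fintype ι] [Fintype κ] [Fintype l] (π : Measure J)
  [IsProbabilityMeasure π]

instance isProbabilityMeasure_stepMeasureIdx (P : Kernel J J) [IsMarkovKernel P] :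
    IsProbabilityMeasure (stepMeasureIdx π P ι) :=
  ⟨by
    rw [stepMeasureIdx, Measure.bind_apply MeasurableSet.univ (measurable_pi_const P).aemeasurable]
    simp⟩

/-- A star density with fewer leaves is a marginal of the star density with more leaves. -/
theorem stepDensityIdx_ae_eq_lintegral (P : Kernel J J) [IsMarkovKernel P] (e : ι ⊕ κ ≃ l)
    (h : stepMeasureIdx π P l ≪ Measure.pi fun _ => π) :
    stepDensityIdx π P ι =ᵐ[Measure.pi fun _ => π]
      fun y => ∫⁻ z, stepDensityIdx π P l (glue e (y, z)) ∂(Measure.pi fun _ => π) := by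
  have hs : Measurable (stepDensityIdx π P l) := Measure.measurable_rnDeriv _ _
  have hsg : Measurable fun q => stepDensityIdx π P l (glue e q) := hs.comp (measurable_glue e)
  have hg : Measurable fun y : ι → J =>
      ∫⁻ z, stepDensityIdx π P l (glue e (y, z)) ∂(Measure.pi fun _ : κ => π) :=
    hsg.lintegral_prod_right'
  suffices hkey : stepMeasureIdx π P ι = (Measure.pi fun _ => π).withDensity fun y : ι → J =>
      ∫⁻ z, stepDensityIdx π P l (glue e (y, z)) ∂(Measure.pi fun _ : κ => π) by
    rw [stepDensityIdx, hkey]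
    exact Measure.rnDeriv_withDensity _ hg
  ext A hA
  set r : (l → J) → ι → J := fun z i => z (e (.inl i))
  have hrA : MeasurableSet (r ⁻¹' A) := (measurePreserving_comp_inl e π).measurable hA
  have hAr : stepMeasureIdx π P ι A = stepMeasureIdx π P l (r ⁻¹' A) := by
    rw [stepMeasureIdx, stepMeasureIdx,
      Measure.bind_apply hA (measurable_pi_const P).aemeasurable,
      Measure.bind_apply hrA (measurable_pi_const P).aemeasurable]
    refine lintegral_congr fun x => ?_
    exact ((measurePreserving_comp_inl e (P x)).measure_preimage hA.nullMeasurableSet).symm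
  have hpre : glue e ⁻¹' (r ⁻¹' A) = A ×ˢ (Set.univ : Set (κ → J)) := by
    ext q
    have : r (glue e q) = q.1 := by
      ext i
      exact glue_apply_inl e q i
    simp [this]
  rw [hAr, ← Measure.withDensity_rnDeriv_eq _ _ h, withDensity_apply _ hrA, withDensity_apply _ hA,
    ← (measurePreserving_glue e π).setLIntegral_comp_preimage hrA (Measure.measurable_rnDeriv _ _),
    hpre, ← Measure.prod_restrict, Measure.restrict_univ]
  exact lintegral_prod _ hsg.aemeasurable

theorem measurable_prod_graphon {W : J → J → ℝ≥0∞} (hW : Measurable (Function.uncurry W)) :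
    Measurable fun q : J × (l → J) => ∏ i, W q.1 (q.2 i) :=
  Finset.measurable_prod _ fun i _ =>
    hW.comp (measurable_fst.prodMk ((measurable_pi_apply i).comp measurable_snd))

theorem measurable_sGraphon {W : J → J → ℝ≥0∞} (hW : Measurable (Function.uncurry W)) :
    Measurable (sGraphon π W l) :=
  (measurable_prod_graphon hW).lintegral_prod_left'

theorem sGraphon_eq_lintegral {W : J → J → ℝ≥0∞} (hW : Measurable (Function.uncurry W))
    (hreg : ∀ᵐ x ∂π, ∫⁻ y, W x y ∂π = 1) (e : ι ⊕ κ ≃ l) (y : ι → J) :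
    sGraphon π W ι y = ∫⁻ z, sGraphon π W l (glue e (y, z)) ∂(Measure.pi fun _ => π) := by
  have hWx : ∀ x, Measurable (W x) := fun x => hW.comp measurable_prodMk_left
  have hm : Measurable fun q : (κ → J) × J => ∏ i, W q.2 (glue e (y, q.1) i) :=
    (measurable_prod_graphon hW).comp (measurable_snd.prodMk
      ((measurable_glue e).comp (measurable_const.prodMk measurable_fst)))
  simp only [sGraphon]
  rw [lintegral_lintegral_swap hm.aemeasurable]
  refine lintegral_congr_ae ?_
  filter_upwards [hreg] with x hx
  simp_rw [← e.prod_comp, Fintype.prod_sum_type, glue_apply_inl, glue_apply_inr]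
  have hprod : Measurable fun z : κ → J => ∏ i, W x (z i) :=
    Finset.measurable_prod _ fun i _ => (hWx x).comp (measurable_pi_apply i)
  rw [lintegral_const_mul _ hprod, lintegral_pi_prod_eq_prod π fun _ => hWx x]
  simp [hx]

theorem lintegral_sGraphon {W : J → J → ℝ≥0∞} (hW : Measurable (Function.uncurry W))
    (hreg : ∀ᵐ x ∂π, ∫⁻ y, W x y ∂π = 1) :
    ∫⁻ y, sGraphon π W l y ∂(Measure.pi fun _ => π) = 1 := by
  have hWx : ∀ x, Measurable (W x) := fun x => hW.comp measurable_prodMk_left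
  have hm : Measurable fun q : (l → J) × J => ∏ i, W q.2 (q.1 i) :=
    (measurable_prod_graphon hW).comp measurable_swap
  simp only [sGraphon]
  rw [lintegral_lintegral_swap hm.aemeasurable]
  simp_rw [fun x => lintegral_pi_prod_eq_prod π fun _ : l => hWx x]
  rw [lintegral_congr_ae (g := fun _ => 1) (by filter_upwards [hreg] with x hx; simp [hx])]
  simp

end Star

/-- Jensen's inequality for powers on a probability space. -/
theorem lintegral_rpow_le_lintegral_rpow {α : Type*} [MeasurableSpace α] (ν : Measure α)
    [IsProbabilityMeasure ν] {f : α → ℝ≥0∞} (hf : AEMeasurable f ν) {p : ℕ} (hp : 0 < p) :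
    (∫⁻ a, f a ∂ν) ^ (p : ℝ) ≤ ∫⁻ a, f a ^ (p : ℝ) ∂ν := by
  have hp' : (p : ℝ) ≠ 0 := by exact_mod_cast hp.ne'
  have h := lintegral_prod_rpow_inv_le ν {()} (f := fun _ a => f a ^ (p : ℝ))
    (fun _ _ => hf.pow_const _) hp (by simpa using Nat.one_le_iff_ne_zero.2 hp.ne')
  simp only [Finset.prod_singleton, ← ENNReal.rpow_mul, mul_inv_cancel₀ hp', ENNReal.rpow_one] at h
  have h2 := ENNReal.rpow_le_rpow h (z := (p : ℝ)) (by positivity)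
  rwa [← ENNReal.rpow_mul, inv_mul_cancel₀ hp', ENNReal.rpow_one] at h2

/-- Taking marginals does not increase the `L^p` distance. -/
theorem lintegral_dist_rpow_le_of_marginal {ι κ l X : Type*} [Fintype ι] [Fintype κ] [Fintype l]
    [MeasurableSpace X] (μ : Measure X) [IsProbabilityMeasure μ] (e : ι ⊕ κ ≃ l)
    {F G : (l → X) → ℝ≥0∞} (hF : Measurable F) (hG : Measurable G) {f g : (ι → X) → ℝ≥0∞}
    (hf : f =ᵐ[Measure.pi fun _ => μ] fun y => ∫⁻ z, F (glue e (y, z)) ∂(Measure.pi fun _ => μ))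
    (hg : g =ᵐ[Measure.pi fun _ => μ] fun y => ∫⁻ z, G (glue e (y, z)) ∂(Measure.pi fun _ => μ))
    {p : ℕ} (hp : 0 < p) :
    ∫⁻ y, ((f y - g y) + (g y - f y)) ^ (p : ℝ) ∂(Measure.pi fun _ => μ)
      ≤ ∫⁻ x, ((F x - G x) + (G x - F x)) ^ (p : ℝ) ∂(Measure.pi fun _ => μ) := by
  have hD : Measurable fun x => (F x - G x) + (G x - F x) := (hF.sub hG).add (hG.sub hF)
  have hDp : Measurable fun q => (F (glue e q) - G (glue e q) + (G (glue e q) - F (glue e q)))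
      ^ (p : ℝ) := (hD.pow_const _).comp (measurable_glue e)
  rw [← (measurePreserving_glue e μ).lintegral_comp (hD.pow_const _),
    lintegral_prod _ hDp.aemeasurable]
  refine lintegral_mono_ae ?_
  filter_upwards [hf, hg] with y hfy hgy
  have hmy : Measurable fun z : κ → X => glue e (y, z) :=
    (measurable_glue e).comp measurable_prodMk_left
  refine le_trans (ENNReal.rpow_le_rpow ?_ (by positivity))
    (lintegral_rpow_le_lintegral_rpow _ (hD.comp hmy).aemeasurable hp)
  rw [hfy, hgy]
  simp only [Function.comp_def]
  have hFG : Measurable fun z : κ → X => F (glue e (y, z)) - G (glue e (y, z)) :=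
    (hF.sub hG).comp hmy
  rw [lintegral_add_left hFG]
  exact add_le_add (lintegral_sub_le _ _ (hG.comp hmy)) (lintegral_sub_le _ _ (hF.comp hmy))

theorem ENNReal.enorm_toReal_sub_toReal {a b : ℝ≥0∞} (ha : a ≠ ⊤) (hb : b ≠ ⊤) :
    ‖a.toReal - b.toReal‖ₑ = (a - b) + (b - a) := by
  lift a to NNReal using ha
  lift b to NNReal using hb
  rw [← edist_eq_enorm_sub]
  simp only [ENNReal.coe_toReal]
  rw [show edist (a : ℝ) (b : ℝ) = edist a b from rfl, edist_nndist, NNReal.nndist_eq]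
  norm_cast
  rcases le_total a b with h | h <;> simp [tsub_eq_zero_of_le h]

theorem tGraphon_empty {U W' : Type*} [Fintype U] [Fintype W'] (π : Measure J) [IsProbabilityMeasure π]
    (W : J → J → ℝ≥0∞) :
    tGraphon π W (∅ : Finset (U × W')) = 1 := by
  simp [tGraphon]

section Bigraph

variable {U W' : Type*} [Fintype U] [Fintype W'] [DecidableEq U] [DecidableEq W']

theorem tGraphon_eq_lintegral_prod_sGraphon (π : Measure J) [IsProbabilityMeasure π]
    {W : J → J → ℝ≥0∞} (hW : Measurable (Function.uncurry W)) (hsymm : ∀ x y, W x y = W y x)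
    (E : Finset (U × W')) :
    tGraphon π W E
      = ∫⁻ x : U → J, ∏ w : W', sGraphon π W (↥(nbrW E w)) (fun u => x u.1)
          ∂(Measure.pi fun _ : U => π) := by
  refine lintegral_congr fun x => ?_
  have hE : ∀ y : W' → J, ∏ e ∈ E, W (x e.1) (y e.2)
      = ∏ w : W', ∏ u : ↥(nbrW E w), W (y w) (x u) := by
    intro y
    rw [Finset.prod_finset_product_right E Finset.univ (fun w => nbrW E w)
      (fun q => by simp [nbrW])]
    refine Finset.prod_congr rfl fun w _ => ?_
    rw [← Finset.prod_coe_sort]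
    exact Finset.prod_congr rfl fun u _ => hsymm _ _
  simp_rw [hE]
  exact lintegral_pi_prod_eq_prod π (f := fun w a => ∏ u : ↥(nbrW E w), W a (x u)) fun w =>
    Finset.measurable_prod _ fun u _ => hW.comp measurable_prodMk_right

theorem stepDensityIdx_ae_eq_one_of_isEmpty (π : Measure J) [IsProbabilityMeasure π]
    (P : Kernel J J) [IsMarkovKernel P] (ι : Type*) [Fintype ι] [IsEmpty ι] :
    stepDensityIdx π P ι =ᵐ[Measure.pi fun _ => π] fun _ => 1 := by
  have h : stepMeasureIdx π P ι = Measure.pi fun _ => π := by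
    ext A hA
    rw [stepMeasureIdx, Measure.bind_apply hA (measurable_pi_const P).aemeasurable]
    have hpi : ∀ μ : Measure J, (Measure.pi fun _ : ι => μ) = Measure.dirac isEmptyElim :=
      fun μ => Measure.pi_of_empty _ _
    simp [hpi]
  rw [stepDensityIdx, h]
  exact Measure.rnDeriv_self _

theorem tEta_empty (π : Measure J) [IsProbabilityMeasure π] (P : Kernel J J) [IsMarkovKernel P] :
    tEta π P (∅ : Finset (U × W')) = 1 := by
  have h : ∀ᵐ x ∂(Measure.pi fun _ : U => π), ∀ w : W',
      stepDensityIdx π P (↥(nbrW (∅ : Finset (U × W')) w)) (fun u => x u.1) = 1 := by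
    refine ae_all_iff.2 fun w => ?_
    have : IsEmpty ↥(nbrW (∅ : Finset (U × W')) w) := ⟨fun u => by simpa [nbrW] using u.2⟩
    exact (measurePreserving_restrict_finset _ π).quasiMeasurePreserving.ae
      (stepDensityIdx_ae_eq_one_of_isEmpty π P _)
  rw [tEta, lintegral_congr_ae (g := fun _ => 1) (by filter_upwards [h] with x hx; simp [hx])]
  simp

end Bigraph

/-- **Theorem (densities converge along `(k,p)`-limits of graphons).**
Let `(J, η)` be a `(k,p)`-loose Markov space, and let `(W_n)` be a sequence of `1`-regular
graphons on `(J, π)` such that `η` is the `(k,p)`-limit of `(W_n)`: `s_k^{W_n} → s_k^η` in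
`L^p(π^k)` and `‖s_k^{W_n}‖_{L^p(π^k)} ≤ C` for a constant `C` independent of `n`.  Let
`G = (U, W, E)` be a bigraph with `deg(u) ≤ p` for all `u ∈ U` and `deg(w) ≤ k` for all
`w ∈ W`.  Then `t(G, η) < ∞` and `t(G, W_n) → t(G, η)`. -/
theorem tendsto_tGraphon_of_kpLimit
    {U W' : Type*} [Fintype U] [Fintype W'] [DecidableEq U] [DecidableEq W']
    [StandardBorelSpace J]
    (η : Measure (J × J)) [IsProbabilityMeasure η]
    (hsym : η.map Prod.swap = η)
    (P : Kernel J J) [IsMarkovKernel P]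
    (hP : ∀ A B : Set J, MeasurableSet A → MeasurableSet B →
      η (A ×ˢ B) = ∫⁻ x in A, P x B ∂(η.map Prod.fst))
    (k p : ℕ) (hloose : KPLoose (η.map Prod.fst) P k p)
    (Wn : ℕ → J → J → ℝ≥0∞)
    (hWmeas : ∀ n, Measurable (Function.uncurry (Wn n)))
    (hWsym : ∀ n x y, Wn n x y = Wn n y x)
    (hWreg : ∀ n, ∀ᵐ x ∂(η.map Prod.fst), ∫⁻ y, Wn n x y ∂(η.map Prod.fst) = 1)
    (hLp : Tendsto
      (fun n => eLpNorm
        (fun z => (sGraphon (η.map Prod.fst) (Wn n) (Fin k) z).toReal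
          - (stepDensityIdx (η.map Prod.fst) P (Fin k) z).toReal) p
        (Measure.pi fun _ : Fin k => η.map Prod.fst))
      atTop (nhds 0))
    (C : ℝ≥0∞) (hC : C ≠ ⊤)
    (hbd : ∀ n, eLpNorm
        (fun z => (sGraphon (η.map Prod.fst) (Wn n) (Fin k) z).toReal) p
        (Measure.pi fun _ : Fin k => η.map Prod.fst) ≤ C)
    (E : Finset (U × W'))
    (hdegW : ∀ w : W', (nbrW E w).card ≤ k)
    (hdegU : ∀ u : U, (nbrU E u).card ≤ p) :
    tEta (η.map Prod.fst) P E < ⊤ ∧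
    Tendsto (fun n => tGraphon (η.map Prod.fst) (Wn n) E) atTop
      (nhds (tEta (η.map Prod.fst) P E)) := by
  have : IsProbabilityMeasure (η.map Prod.fst) :=
    Measure.isProbabilityMeasure_map measurable_fst.aemeasurable
  set π := η.map Prod.fst
  rcases Nat.eq_zero_or_pos p with rfl | hp
  · have hE : E = ∅ := by
      refine Finset.eq_empty_of_forall_notMem fun e he => ?_
      have hmem : e.2 ∈ nbrU E e.1 := by simpa [nbrU] using he
      have := Finset.card_pos.2 ⟨_, hmem⟩
      have := hdegU e.1
      omega
    subst hE
    simp only [tGraphon_empty, tEta_empty]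
    exact ⟨ENNReal.one_lt_top, tendsto_const_nhds⟩
  have hp' : (0 : ℝ) < p := by exact_mod_cast hp
  set s := stepDensityIdx π P (Fin k)
  have hs : Measurable s := Measure.measurable_rnDeriv _ _
  have hsn : ∀ n, Measurable (sGraphon π (Wn n) (Fin k)) :=
    fun n => measurable_sGraphon π (hWmeas n)
  have hs_top : ∀ᵐ z ∂(Measure.pi fun _ : Fin k => π), s z ≠ ⊤ := Measure.rnDeriv_ne_top _ _
  have hsn_top : ∀ n, ∀ᵐ z ∂(Measure.pi fun _ : Fin k => π), sGraphon π (Wn n) (Fin k) z ≠ ⊤ := by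
    intro n
    filter_upwards [ae_lt_top (hsn n) (by simp [lintegral_sGraphon π (hWmeas n) (hWreg n)])]
      with z hz using hz.ne
  have hdist : Tendsto (fun n => ∫⁻ z, ((sGraphon π (Wn n) (Fin k) z - s z)
      + (s z - sGraphon π (Wn n) (Fin k) z)) ^ (p : ℝ) ∂(Measure.pi fun _ : Fin k => π))
      atTop (nhds 0) := by
    have h := (ENNReal.continuous_rpow_const (y := (p : ℝ))).tendsto 0 |>.comp hLp
    rw [ENNReal.zero_rpow_of_pos hp'] at h
    refine h.congr fun n => ?_
    rw [Function.comp_apply, eLpNorm_eq_lintegral_rpow_enorm_toReal (by exact_mod_cast hp.ne')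
      (ENNReal.natCast_ne_top p), ENNReal.toReal_natCast, ← ENNReal.rpow_mul,
      one_div_mul_cancel hp'.ne', ENNReal.rpow_one]
    refine lintegral_congr_ae ?_
    filter_upwards [hs_top, hsn_top n] with z h1 h2
    rw [ENNReal.enorm_toReal_sub_toReal h2 h1]
  have hemb : ∀ w : W', Nonempty (↥(nbrW E w) ⊕ Fin (k - (nbrW E w).card) ≃ Fin k) := by
    intro w
    refine ⟨Fintype.equivOfCardEq ?_⟩
    simpa using Nat.add_sub_cancel' (hdegW w)
  have hres := fun w => measurePreserving_restrict_finset (nbrW E w) π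
  have hsw : ∀ w, Measurable (stepDensityIdx π P ↥(nbrW E w)) :=
    fun w => Measure.measurable_rnDeriv _ _
  have hsnw : ∀ n w, Measurable (sGraphon π (Wn n) ↥(nbrW E w)) :=
    fun n w => measurable_sGraphon π (hWmeas n)
  have hupd : ∀ (w : W'), ∀ u ∉ nbrW E w, ∀ (x : U → J) (a : J),
      (fun v : ↥(nbrW E w) => Function.update x u a v) = fun v : ↥(nbrW E w) => x v := by
    intro w u hu x a
    ext v
    exact Function.update_of_ne (fun h : (v : U) = u => hu (h ▸ v.2)) _ _
  have hmarg : ∀ w (e : ↥(nbrW E w) ⊕ Fin (k - (nbrW E w).card) ≃ Fin k),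
      stepDensityIdx π P ↥(nbrW E w) =ᵐ[Measure.pi fun _ => π]
        fun y => ∫⁻ z, s (glue e (y, z)) ∂(Measure.pi fun _ => π) :=
    fun w e => stepDensityIdx_ae_eq_lintegral π P e hloose.1
  have key := tendsto_lintegral_prod π (fun w => nbrW E w)
    (a := fun n w x => sGraphon π (Wn n) (↥(nbrW E w)) (fun u => x u.1))
    (b := fun w x => stepDensityIdx π P (↥(nbrW E w)) (fun u => x u.1))
    (fun n w => (hsnw n w).comp (hres w).measurable) (fun w => (hsw w).comp (hres w).measurable)
    (fun n w u hu x a => by rw [hupd w u hu]) (fun w u hu x a => by rw [hupd w u hu]) hp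
    (fun u => by simpa [nbrW, nbrU] using hdegU u) ?_ ?_
  · simp_rw [fun n => tGraphon_eq_lintegral_prod_sGraphon π (hWmeas n) (hWsym n) E]
    exact key
  · intro w
    obtain ⟨e⟩ := hemb w
    rw [(hres w).lintegral_comp (f := fun y => stepDensityIdx π P ↥(nbrW E w) y ^ (p : ℝ))
      ((hsw w).pow_const _)]
    have h := lintegral_dist_rpow_le_of_marginal π e hs measurable_const (g := fun _ => 0)
      (G := fun _ => 0) (hmarg w e) (by simp) hp
    simp only [tsub_zero, zero_tsub, add_zero, ENNReal.rpow_natCast] at h ⊢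
    exact h.trans_lt hloose.2
  · intro w
    obtain ⟨e⟩ := hemb w
    refine tendsto_of_tendsto_of_tendsto_of_le_of_le tendsto_const_nhds hdist
      (fun _ => zero_le) fun n => ?_
    have hD : Measurable fun y => ((sGraphon π (Wn n) ↥(nbrW E w) y
        - stepDensityIdx π P ↥(nbrW E w) y) + (stepDensityIdx π P ↥(nbrW E w) y
        - sGraphon π (Wn n) ↥(nbrW E w) y)) ^ (p : ℝ) :=
      (((hsnw n w).sub (hsw w)).add ((hsw w).sub (hsnw n w))).pow_const _
    refine ((hres w).lintegral_comp hD).le.trans ?_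
    exact lintegral_dist_rpow_le_of_marginal π e (hsn n) hs
      (Eventually.of_forall fun y => sGraphon_eq_lintegral π (hWmeas n) (hWreg n) e y)
      (hmarg w e) hp
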